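/- arXiv:2206.10580 — 10 statements merged into one kernel-verified Lean document; each statement's English description precedes it below -/
import Mathlib

section
/- Let D be the unique ℂ-linear derivation of the free algebra A with D(u) = 2·u·v·u² − 2·u·v·u − κ₁·u² + κ₂·u + z·(−u·v·u − v·u² + u·v + v·u + κ₄·u + (κ₁ − κ₂ − κ₄)·1) and D(v) = −v·u²·v − 2·v·u·v·u + 2·v·u·v + (1/2)(κ₁+κ₃)·u·v + (1/2)(3κ₁−κ₃)·v·u − κ₂·v + (1/4)(κ₃²−κ₁²)·1 + z·(v·u·v + v²·u − v² − κ₄·v) (the auxiliary autonomous system of the non-abelian Painlevé-6 system ³P₆). Then the Okamoto element J = v·u²·v·u − v·u²·v − (1/2)(κ₃+κ₁)·u·v·u + (1/2)(κ₃−κ₁)·v·u² + (1/2)(κ₁+κ₃)·u·v + (1/2)(2κ₂−κ₁−κ₃)·v·u − (1/4)(κ₃²−κ₁²)·u + z·(−v·u·v·u + v·u·v + κ₄·v·u + (κ₁−κ₂−κ₄)·v) satisfies D(J) = 0. -/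
/-- The free associative unital algebra over ℂ on two generators. -/
noncomputable abbrev A : Type := FreeAlgebra ℂ (Fin 2)

/-- The first generator `u` of the free algebra. -/
noncomputable def u : A := FreeAlgebra.ι ℂ (0 : Fin 2)

/-- The second generator `v` of the free algebra. -/
noncomputable def v : A := FreeAlgebra.ι ℂ (1 : Fin 2)

theorem okamoto_integral_P6_3 (κ₁ κ₂ κ₃ κ₄ z : ℂ)
    (D : A →ₗ[ℂ] A)
    (hLeibniz : ∀ a b : A, D (a * b) = D a * b + a * D b)
    (hDu : D u =
      2 * (u*v*u^2) - 2 * (u*v*u) - κ₁ • u^2 + κ₂ • u + z • (-(u*v*u) - v*u^2 + u*v + v*u + κ₄ • u + (κ₁ - κ₂ - κ₄) • (1 : A)))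
    (hDv : D v =
      -(v*u^2*v) - 2 * (v*u*v*u) + 2 * (v*u*v) + ((1/2) * (κ₁ + κ₃)) • (u*v) + ((1/2) * (3*κ₁ - κ₃)) • (v*u) - κ₂ • v + ((1/4) * (κ₃^2 - κ₁^2)) • (1 : A) + z • (v*u*v + v^2*u - v^2 - κ₄ • v))
    : D (v*u^2*v*u - v*u^2*v - ((1/2) * (κ₃ + κ₁)) • (u*v*u) + ((1/2) * (κ₃ - κ₁)) • (v*u^2) + ((1/2) * (κ₁ + κ₃)) • (u*v) + ((1/2) * (2*κ₂ - κ₁ - κ₃)) • (v*u) - ((1/4) * (κ₃^2 - κ₁^2)) • u + z • (-(v*u*v*u) + v*u*v + κ₄ • (v*u) + (κ₁ - κ₂ - κ₄) • v)) = 0 := by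
  have hDpow : ∀ a : A, D (a ^ 2) = D a * a + a * D a := fun a => by rw [pow_two, hLeibniz]
  simp only [map_add, map_sub, map_neg, map_smul, hLeibniz, hDpow, hDu, hDv]
  simp only [pow_two, two_mul, mul_add, add_mul, mul_sub, sub_mul, neg_mul, mul_neg, smul_mul_assoc,
    mul_smul_comm, mul_one, one_mul, mul_assoc]
  module
end

section
/- Let D be the unique ℂ-linear derivation of the free algebra A with D(u) = u·v·u² + v·u³ − u·v·u − v·u² − κ₁·u² + κ₂·u + z·(−u·v·u − v·u² + u·v + v·u + κ₄·u + (κ₁ − κ₂ − κ₄)·1) and D(v) = −2·v·u·v·u − v²·u² + v·u·v + v²·u + 2κ₁·v·u − κ₂·v + κ₃·1 + z·(v·u·v + v²·u − v² − κ₄·v) (the auxiliary autonomous system of the non-abelian Painlevé-6 system ⁶P₆). Then the Okamoto element J = v·u·v·u² − v·u·v·u − κ₁·v·u² + κ₂·v·u − κ₃·u + z·(−v·u·v·u + v·u·v + κ₄·v·u + (κ₁−κ₂−κ₄)·v) satisfies D(J) = 0. -/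
theorem okamoto_integral_P6_6 (κ₁ κ₂ κ₃ κ₄ z : ℂ)
    (D : A →ₗ[ℂ] A)
    (hLeibniz : ∀ a b : A, D (a * b) = D a * b + a * D b)
    (hDu : D u =
      u*v*u^2 + v*u^3 - u*v*u - v*u^2 - κ₁ • u^2 + κ₂ • u + z • (-(u*v*u) - v*u^2 + u*v + v*u + κ₄ • u + (κ₁ - κ₂ - κ₄) • (1 : A)))
    (hDv : D v =
      -(2 * (v*u*v*u)) - v^2*u^2 + v*u*v + v^2*u + (2*κ₁) • (v*u) - κ₂ • v + κ₃ • (1 : A) + z • (v*u*v + v^2*u - v^2 - κ₄ • v))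
    : D (v*u*v*u^2 - v*u*v*u - κ₁ • (v*u^2) + κ₂ • (v*u) - κ₃ • u + z • (-(v*u*v*u) + v*u*v + κ₄ • (v*u) + (κ₁ - κ₂ - κ₄) • v)) = 0 := by
  simp only [pow_succ, pow_zero, one_mul, map_add, map_sub, map_neg, map_smul, hLeibniz, hDu, hDv]
  simp only [two_mul, mul_add, add_mul, mul_sub, sub_mul, smul_add, smul_sub, smul_neg, neg_mul,
    mul_neg, mul_assoc, smul_mul_assoc, mul_smul_comm, mul_one, one_mul]
  module
end

section
/- Let D be the unique ℂ-linear derivation of the free algebra A with D(u) = u²·v·u + u·v·u² − u²·v − u·v·u − κ₁·u² + κ₂·u + z·(−u·v·u − v·u² + u·v + v·u + κ₄·u + (κ₁ − κ₂ − κ₄)·1) and D(v) = −u·v·u·v − v·u²·v − v·u·v·u + u·v² + v·u·v + κ₁·u·v + κ₁·v·u − κ₂·v + κ₃·1 + z·(v·u·v + v²·u − v² − κ₄·v) (the auxiliary autonomous system of the non-abelian Painlevé-6 system ⁷P₆). Then the Okamoto element J = u·v·u·v·u − u·v·u·v − κ₁·u·v·u + κ₂·u·v − κ₃·u + z·(−v·u·v·u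 + v·u·v + κ₄·v·u + (κ₁−κ₂−κ₄)·v) satisfies D(J) = 0. -/
theorem okamoto_integral_P6_7 (κ₁ κ₂ κ₃ κ₄ z : ℂ)
    (D : A →ₗ[ℂ] A)
    (hLeibniz : ∀ a b : A, D (a * b) = D a * b + a * D b)
    (hDu : D u =
      u^2*v*u + u*v*u^2 - u^2*v - u*v*u - κ₁ • u^2 + κ₂ • u + z • (-(u*v*u) - v*u^2 + u*v + v*u + κ₄ • u + (κ₁ - κ₂ - κ₄) • (1 : A)))
    (hDv : D v =
      -(u*v*u*v) - v*u^2*v - v*u*v*u + u*v^2 + v*u*v + κ₁ • (u*v) + κ₁ • (v*u) - κ₂ • v + κ₃ • (1 : A) + z • (v*u*v + v^2*u - v^2 - κ₄ • v))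
    : D (u*v*u*v*u - u*v*u*v - κ₁ • (u*v*u) + κ₂ • (u*v) - κ₃ • u + z • (-(v*u*v*u) + v*u*v + κ₄ • (v*u) + (κ₁ - κ₂ - κ₄) • v)) = 0 := by
  simp only [map_add, map_sub, map_neg, map_smul, hLeibniz, hDu, hDv]
  simp only [pow_two, mul_add, add_mul, mul_sub, sub_mul, neg_mul, mul_neg, smul_mul_assoc,
    mul_smul_comm, mul_one, one_mul, mul_assoc, smul_add, smul_sub, smul_neg]
  module
end

section
/- Let D be the unique ℂ-linear derivation of the free algebra A with D(u) = u²·v·u + u·v·u² − 2·u·v·u − κ₁·u² + κ₂·u + z·(−u²·v − v·u² + u·v + v·u + κ₄·u + (κ₁ − κ₂ − κ₄)·1) and D(v) = −u·v·u·v − v·u·v·u − v·u²·v + 2·v·u·v + κ₁·u·v + κ₁·v·u − κ₂·v + κ₃·1 + z·(u·v² + v²·u − v² − κ₄·v) (the auxiliary autonomous system of the non-abelian Hamiltonian Painlevé-6 system P₆ᴴ). Then the commutator I = u·v − v·u satisfies D(I) = 0. -/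
theorem commutator_integral_P6H (κ₁ κ₂ κ₃ κ₄ z : ℂ)
    (D : A →ₗ[ℂ] A)
    (hLeibniz : ∀ a b : A, D (a * b) = D a * b + a * D b)
    (hDu : D u =
      u^2*v*u + u*v*u^2 - 2 * (u*v*u) - κ₁ • u^2 + κ₂ • u + z • (-(u^2*v) - v*u^2 + u*v + v*u + κ₄ • u + (κ₁ - κ₂ - κ₄) • (1 : A)))
    (hDv : D v =
      -(u*v*u*v) - v*u*v*u - v*u^2*v + 2 * (v*u*v) + κ₁ • (u*v) + κ₁ • (v*u) - κ₂ • v + κ₃ • (1 : A) + z • (u*v^2 + v^2*u - v^2 - κ₄ • v))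
    : D (u*v - v*u) = 0 := by
  rw [map_sub, hLeibniz, hLeibniz, hDu, hDv]
  simp only [two_mul, pow_two, mul_add, add_mul, mul_sub, sub_mul, neg_mul, mul_neg, smul_add,
    smul_sub, smul_neg, sub_smul, smul_mul_assoc, mul_smul_comm, mul_one, one_mul, mul_assoc]
  module
end

section
/- Let D be the unique ℂ-linear derivation of the free algebra A with D(u) = 2·u·v·u² − 2·u·v·u − 2·v·u² − κ₁·u² + 2·v·u + (κ₁+κ₂)·u − κ₂·1 + κ₄·z·u and D(v) = −v·u²·v − 2·v·u·v·u + 2·v·u·v + 2·v²·u + (1/2)(κ₁+κ₃)·u·v + (1/2)(3κ₁−κ₃)·v·u − v² − (κ₁+κ₂)·v + (1/4)(κ₃²−κ₁²)·1 − κ₄·z·v (the auxiliary autonomous system of the non-abelian Painlevé-5 system ¹P₅). Then the Okamoto element J = v·u²·v·u − 2·v·u·v·u − (1/2)(κ₃+κ₁)·u·v·u + (1/2)(κ₃−κ₁)·v·u² + v²·u + (κ₁+κ₂)·v·u − (1/4)(κ₃²−κ₁²)·u − κ₂·v + κ₄·z·v·u satisfies D(J) = 0. -/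
theorem okamoto_integral_P5_1 (κ₁ κ₂ κ₃ κ₄ z : ℂ)
    (D : A →ₗ[ℂ] A)
    (hLeibniz : ∀ a b : A, D (a * b) = D a * b + a * D b)
    (hDu : D u =
      2 * (u*v*u^2) - 2 * (u*v*u) - 2 * (v*u^2) - κ₁ • u^2 + 2 * (v*u) + (κ₁ + κ₂) • u - κ₂ • (1 : A) + (κ₄*z) • u)
    (hDv : D v =
      -(v*u^2*v) - 2 * (v*u*v*u) + 2 * (v*u*v) + 2 * (v^2*u) + ((1/2) * (κ₁ + κ₃)) • (u*v) + ((1/2) * (3*κ₁ - κ₃)) • (v*u) - v^2 - (κ₁ + κ₂) • v + ((1/4) * (κ₃^2 - κ₁^2)) • (1 : A) - (κ₄*z) • v)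
    : D (v*u^2*v*u - 2 * (v*u*v*u) - ((1/2) * (κ₃ + κ₁)) • (u*v*u) + ((1/2) * (κ₃ - κ₁)) • (v*u^2) + v^2*u + (κ₁ + κ₂) • (v*u) - ((1/4) * (κ₃^2 - κ₁^2)) • u - κ₂ • v + (κ₄*z) • (v*u)) = 0 := by
  simp only [map_add, map_sub, map_smul, pow_two, two_mul, hLeibniz, hDu, hDv]
  simp only [mul_add, add_mul, mul_sub, sub_mul, smul_mul_assoc, mul_smul_comm, mul_one, one_mul,
    neg_mul, mul_neg, smul_add, smul_sub, smul_neg, smul_smul, ← mul_assoc]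
  module
end

section
/- Let D be the unique ℂ-linear derivation of the free algebra A with D(u) = u·v·u² + v·u³ − 2·u·v·u − 2·v·u² − κ₁·u² + u·v + v·u + (κ₁+κ₂)·u − κ₂·1 + κ₄·z·u and D(v) = −2·v·u·v·u − v²·u² + 2·v·u·v + 2·v²·u + 2κ₁·v·u − v² − (κ₁+κ₂)·v + κ₃·1 − κ₄·z·v (the auxiliary autonomous system of the non-abelian Painlevé-5 system ³P₅). Then the Okamoto element J = v·u·v·u² − 2·v·u·v·u − κ₁·v·u² + v·u·v + (κ₁+κ₂)·v·u − κ₃·u − κ₂·v + κ₄·z·v·u satisfies D(J) = 0. -/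
theorem okamoto_integral_P5_3 (κ₁ κ₂ κ₃ κ₄ z : ℂ)
    (D : A →ₗ[ℂ] A)
    (hLeibniz : ∀ a b : A, D (a * b) = D a * b + a * D b)
    (hDu : D u =
      u*v*u^2 + v*u^3 - 2 * (u*v*u) - 2 * (v*u^2) - κ₁ • u^2 + u*v + v*u + (κ₁ + κ₂) • u - κ₂ • (1 : A) + (κ₄*z) • u)
    (hDv : D v =
      -(2 * (v*u*v*u)) - v^2*u^2 + 2 * (v*u*v) + 2 * (v^2*u) + (2*κ₁) • (v*u) - v^2 - (κ₁ + κ₂) • v + κ₃ • (1 : A) - (κ₄*z) • v)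
    : D (v*u*v*u^2 - 2 * (v*u*v*u) - κ₁ • (v*u^2) + v*u*v + (κ₁ + κ₂) • (v*u) - κ₃ • u - κ₂ • v + (κ₄*z) • (v*u)) = 0 := by
  have h2 : ∀ x : A, (2 : A) * x = (2 : ℂ) • x := fun x => by
    rw [two_mul, two_smul]
  simp only [h2, pow_succ, pow_zero, one_mul] at hDu hDv ⊢
  simp only [map_add, map_sub, map_smul, hLeibniz, hDu, hDv]
  simp only [mul_add, add_mul, mul_sub, sub_mul, neg_mul, mul_neg, smul_mul_assoc,
    mul_smul_comm, smul_add, smul_sub, smul_neg, smul_smul, mul_one, one_mul, ← mul_assoc]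
  module
end

section
/- Let D be the unique ℂ-linear derivation of the free algebra A with D(u) = u²·v·u + u·v·u² − u²·v − 3·u·v·u − κ₁·u² + 2·u·v + (κ₁+κ₂)·u − κ₂·1 + κ₄·z·u and D(v) = −u·v·u·v − v·u²·v − v·u·v·u + u·v² + 3·v·u·v + κ₁·u·v + κ₁·v·u − v² − (κ₁+κ₂)·v + κ₃·1 − κ₄·z·v (the auxiliary autonomous system of the non-abelian Painlevé-5 system ⁵P₅). Then the Okamoto element J = u·v·u·v·u − u·v·u·v − u·v²·u − κ₁·u·v·u + u·v² + κ₁·u·v + κ₂·v·u − κ₃·u − κ₂·v + κ₄·z·u·v satisfies D(J) = 0. -/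
theorem okamoto_integral_P5_5 (κ₁ κ₂ κ₃ κ₄ z : ℂ)
    (D : A →ₗ[ℂ] A)
    (hLeibniz : ∀ a b : A, D (a * b) = D a * b + a * D b)
    (hDu : D u =
      u^2*v*u + u*v*u^2 - u^2*v - 3 * (u*v*u) - κ₁ • u^2 + 2 * (u*v) + (κ₁ + κ₂) • u - κ₂ • (1 : A) + (κ₄*z) • u)
    (hDv : D v =
      -(u*v*u*v) - v*u^2*v - v*u*v*u + u*v^2 + 3 * (v*u*v) + κ₁ • (u*v) + κ₁ • (v*u) - v^2 - (κ₁ + κ₂) • v + κ₃ • (1 : A) - (κ₄*z) • v)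
    : D (u*v*u*v*u - u*v*u*v - u*v^2*u - κ₁ • (u*v*u) + u*v^2 + κ₁ • (u*v) + κ₂ • (v*u) - κ₃ • u - κ₂ • v + (κ₄*z) • (u*v)) = 0 := by
  have h2 : (2 : A) = (2 : ℂ) • 1 := by rw [ofNat_smul_eq_nsmul, nsmul_one]; norm_cast
  have h3 : (3 : A) = (3 : ℂ) • 1 := by rw [ofNat_smul_eq_nsmul, nsmul_one]; norm_cast
  simp only [map_add, map_sub, map_smul, hLeibniz, pow_two, hDu, hDv, h2, h3]
  simp only [mul_add, add_mul, mul_sub, sub_mul, neg_mul, mul_neg, mul_smul_comm,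
    smul_mul_assoc, one_mul, mul_one, mul_assoc]
  module
end

section
/- Let D be the unique ℂ-linear derivation of the free algebra A with D(u) = 2·u²·v·u − 2·u²·v − 2·u·v·u − κ₁·u² + 2·u·v + (κ₁+κ₂)·u − κ₂·1 + κ₄·z·u and D(v) = −2·u·v·u·v − v·u²·v + 2·u·v² + 2·v·u·v + (1/2)(3κ₁−κ₃)·u·v + (1/2)(κ₁+κ₃)·v·u − v² − (κ₁+κ₂)·v + (1/4)(κ₃²−κ₁²)·1 − κ₄·z·v (the auxiliary autonomous system of the non-abelian Painlevé-5 system ⁷P₅). Then the Okamoto element J = u·v·u²·v − 2·u·v·u·v + (1/2)(κ₃−κ₁)·u²·v − (1/2)(κ₃+κ₁)·u·v·u + u·v² + (κ₁+κ₂)·u·v − (1/4)(κ₃²−κ₁²)·u − κ₂·v + κ₄·z·u·v satisfies D(J) = 0. -/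
theorem okamoto_integral_P5_7 (κ₁ κ₂ κ₃ κ₄ z : ℂ)
    (D : A →ₗ[ℂ] A)
    (hLeibniz : ∀ a b : A, D (a * b) = D a * b + a * D b)
    (hDu : D u =
      2 * (u^2*v*u) - 2 * (u^2*v) - 2 * (u*v*u) - κ₁ • u^2 + 2 * (u*v) + (κ₁ + κ₂) • u - κ₂ • (1 : A) + (κ₄*z) • u)
    (hDv : D v =
      -(2 * (u*v*u*v)) - v*u^2*v + 2 * (u*v^2) + 2 * (v*u*v) + ((1/2) * (3*κ₁ - κ₃)) • (u*v) + ((1/2) * (κ₁ + κ₃)) • (v*u) - v^2 - (κ₁ + κ₂) • v + ((1/4) * (κ₃^2 - κ₁^2)) • (1 : A) - (κ₄*z) • v)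
    : D (u*v*u^2*v - 2 * (u*v*u*v) + ((1/2) * (κ₃ - κ₁)) • (u^2*v) - ((1/2) * (κ₃ + κ₁)) • (u*v*u) + u*v^2 + (κ₁ + κ₂) • (u*v) - ((1/4) * (κ₃^2 - κ₁^2)) • u - κ₂ • v + (κ₄*z) • (u*v)) = 0 := by
  have two_mul_eq_smul (x : A) : 2 * x = (2 : ℂ) • x := by
    rw [two_smul, two_mul]
  simp only [two_mul_eq_smul, pow_two] at hDu hDv ⊢
  simp only [map_add, map_sub, map_smul, hLeibniz, hDu, hDv]
  simp only [mul_add, add_mul, mul_sub, sub_mul, mul_neg, neg_mul, smul_mul_assoc,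
    mul_smul_comm, mul_one, one_mul, mul_assoc]
  module
end

section
/- Let D be the unique ℂ-linear derivation of the free algebra A with D(u) = u³·v + u²·v·u − 2·u²·v − 2·u·v·u − κ₁·u² + u·v + v·u + (κ₁+κ₂)·u − κ₂·1 + κ₄·z·u and D(v) = −u²·v² − 2·u·v·u·v + 2·u·v² + 2·v·u·v + 2κ₁·u·v − v² − (κ₁+κ₂)·v + κ₃·1 − κ₄·z·v (the auxiliary autonomous system of the non-abelian Painlevé-5 system ⁹P₅). Then the Okamoto element J = u²·v·u·v − 2·u·v·u·v − κ₁·u²·v + v·u·v + (κ₁+κ₂)·u·v − κ₃·u − κ₂·v + κ₄·z·u·v satisfies D(J) = 0. -/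
theorem okamoto_integral_P5_9 (κ₁ κ₂ κ₃ κ₄ z : ℂ)
    (D : A →ₗ[ℂ] A)
    (hLeibniz : ∀ a b : A, D (a * b) = D a * b + a * D b)
    (hDu : D u =
      u^3*v + u^2*v*u - 2 * (u^2*v) - 2 * (u*v*u) - κ₁ • u^2 + u*v + v*u + (κ₁ + κ₂) • u - κ₂ • (1 : A) + (κ₄*z) • u)
    (hDv : D v =
      -(u^2*v^2) - 2 * (u*v*u*v) + 2 * (u*v^2) + 2 * (v*u*v) + (2*κ₁) • (u*v) - v^2 - (κ₁ + κ₂) • v + κ₃ • (1 : A) - (κ₄*z) • v)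
    : D (u^2*v*u*v - 2 * (u*v*u*v) - κ₁ • (u^2*v) + v*u*v + (κ₁ + κ₂) • (u*v) - κ₃ • u - κ₂ • v + (κ₄*z) • (u*v)) = 0 := by
  simp only [pow_succ, pow_zero, one_mul, two_mul, map_add, map_sub, map_smul, hLeibniz, hDu, hDv]
  simp only [mul_add, add_mul, mul_sub, sub_mul, mul_neg, neg_mul, mul_one, one_mul,
    smul_mul_assoc, mul_smul_comm, mul_assoc]
  module
end

section
/- Let D be the unique ℂ-linear derivation of the free algebra A with D(u) = u²·v·u + u·v·u² − u²·v − 2·u·v·u − v·u² − κ₁·u² + u·v + v·u + (κ₁+κ₂)·u − κ₂·1 + κ₄·z·u and D(v) = −u·v·u·v − v·u²·v − v·u·v·u + u·v² + 2·v·u·v + v²·u + κ₁·u·v + κ₁·v·u − v² − (κ₁+κ₂)·v + κ₃·1 − κ₄·z·v (the auxiliary autonomous system of the non-abelian Hamiltonian Painlevé-5 system P₅ᴴ). Then the commutator I = u·v − v·u satisfies D(I) = 0. -/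
theorem commutator_integral_P5H (κ₁ κ₂ κ₃ κ₄ z : ℂ)
    (D : A →ₗ[ℂ] A)
    (hLeibniz : ∀ a b : A, D (a * b) = D a * b + a * D b)
    (hDu : D u =
      u^2*v*u + u*v*u^2 - u^2*v - 2 * (u*v*u) - v*u^2 - κ₁ • u^2 + u*v + v*u + (κ₁ + κ₂) • u - κ₂ • (1 : A) + (κ₄*z) • u)
    (hDv : D v =
      -(u*v*u*v) - v*u^2*v - v*u*v*u + u*v^2 + 2 * (v*u*v) + v^2*u + κ₁ • (u*v) + κ₁ • (v*u) - v^2 - (κ₁ + κ₂) • v + κ₃ • (1 : A) - (κ₄*z) • v)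
    : D (u*v - v*u) = 0 := by
  rw [map_sub, hLeibniz, hLeibniz, hDu, hDv]
  simp only [pow_two, two_mul, mul_add, add_mul, mul_sub, sub_mul, mul_neg, neg_mul,
    smul_mul_assoc, mul_smul_comm, one_mul, mul_one, mul_assoc]
  abel
end
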